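/- Let t ≥ 0, let s ∈ ℝ^n be any vector, and let v̂ ∈ ℝ^{(N+1)n} be any vector with blocks v̂_0, …, v̂_N ∈ ℝ^n. Define the residual r = e_1 ⊗ s − (I_{(N+1)n} − S ⊗ (tP)) v̂ with blocks r_0, …, r_N ∈ ℝ^n, and set y = v̂_0 + ⋯ + v̂_N. Then ‖D^{-1} T_N(tP) s − D^{-1} y‖_∞ ≤ Σ_{k=0}^N ψ_k(t) · ‖D^{-1} r_k‖_∞. -/

import Mathlib

open Matrix Finset
open scoped Kronecker

/-- ψ_k(t) = Σ_{m=0}^{N−k} (k!/(m+k)!) t^m -/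
noncomputable def psi (N k : ℕ) (t : ℝ) : ℝ :=
  ∑ m ∈ Finset.range (N - k + 1), ((Nat.factorial k : ℝ) / (Nat.factorial (m + k))) * t ^ m

/-- ψ_k applied to a matrix: Σ_{m=0}^{N−k} (k!/(m+k)!) M^m -/
noncomputable def psiMat (N k : ℕ) {n : ℕ} (M : Matrix (Fin n) (Fin n) ℝ) :
    Matrix (Fin n) (Fin n) ℝ :=
  ∑ m ∈ Finset.range (N - k + 1), ((Nat.factorial k : ℝ) / (Nat.factorial (m + k))) • M ^ m

/-- The (N+1)×(N+1) matrix with subdiagonal entries S_{j+1,j} = 1/j (1-based indexing). -/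
noncomputable def Smat (N : ℕ) : Matrix (Fin (N + 1)) (Fin (N + 1)) ℝ :=
  Matrix.of fun i j => if (i : ℕ) = (j : ℕ) + 1 then 1 / ((j : ℕ) + 1) else 0

/-- The random-walk transition matrix P = A D⁻¹. -/
noncomputable def transP {n : ℕ} (G : SimpleGraph (Fin n)) [DecidableRel G.Adj] :
    Matrix (Fin n) (Fin n) ℝ :=
  G.adjMatrix ℝ * Matrix.diagonal (fun i => ((G.degree i : ℝ))⁻¹)

/-- The inverse degree matrix D⁻¹. -/
noncomputable def Dinv {n : ℕ} (G : SimpleGraph (Fin n)) [DecidableRel G.Adj] :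
    Matrix (Fin n) (Fin n) ℝ :=
  Matrix.diagonal (fun i => ((G.degree i : ℝ))⁻¹)

/-- Weighting by the inverse degrees makes the random walk a contraction for the sup norm. -/
lemma norm_Dinv_mulVec_transP_mulVec_le {n : ℕ} (G : SimpleGraph (Fin n)) [DecidableRel G.Adj]
    (x : Fin n → ℝ) :
    ‖(Dinv G).mulVec ((transP G).mulVec x)‖ ≤ ‖(Dinv G).mulVec x‖ := by
  refine (pi_norm_le_iff_of_nonneg (norm_nonneg _)).2 fun i => ?_
  have hP : (transP G).mulVec x = (G.adjMatrix ℝ).mulVec ((Dinv G).mulVec x) := by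
    rw [Matrix.mulVec_mulVec]; rfl
  rw [hP]
  generalize (Dinv G).mulVec x = z
  rw [Dinv, Matrix.mulVec_diagonal, SimpleGraph.adjMatrix_mulVec_apply, norm_mul]
  have hsum : ‖∑ u ∈ G.neighborFinset i, z u‖ ≤ (G.degree i : ℝ) * ‖z‖ := by
    refine (norm_sum_le_of_le _ fun u _ => norm_le_pi_norm z u).trans_eq ?_
    rw [Finset.sum_const, nsmul_eq_mul, SimpleGraph.card_neighborFinset_eq_degree]
  calc ‖((G.degree i : ℝ))⁻¹‖ * ‖∑ u ∈ G.neighborFinset i, z u‖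
      ≤ ((G.degree i : ℝ))⁻¹ * ((G.degree i : ℝ) * ‖z‖) := by
        rw [Real.norm_of_nonneg (by positivity)]
        gcongr
    _ = ((G.degree i : ℝ))⁻¹ * (G.degree i : ℝ) * ‖z‖ := by ring
    _ ≤ 1 * ‖z‖ := by gcongr; exact inv_mul_le_one
    _ = ‖z‖ := one_mul _

lemma psi_succ {N k : ℕ} (hk : k ≤ N) (t : ℝ) :
    psi (N + 1) k t
      = psi N k t + (Nat.factorial k : ℝ) / (Nat.factorial (N + 1)) * t ^ (N + 1 - k) := by
  rw [psi, psi, show N + 1 - k + 1 = (N - k + 1) + 1 by omega, Finset.sum_range_succ,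
    show N - k + 1 + k = N + 1 by omega, show N + 1 - k = N - k + 1 by omega]

lemma psi_self (N : ℕ) (t : ℝ) : psi N N t = 1 := by
  simp [psi, Nat.factorial_ne_zero]

/-- The explicit solution of the recursion `a (k + 1) ≤ t / (k + 1) * a k + ρ (k + 1)`. -/
lemma le_sum_of_le_div_mul_add {N : ℕ} {t : ℝ} (ht : 0 ≤ t) {a ρ : ℕ → ℝ} (h0 : a 0 ≤ ρ 0)
    (hstep : ∀ k < N, a (k + 1) ≤ t / (k + 1) * a k + ρ (k + 1)) {k : ℕ} (hk : k ≤ N) :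
    a k ≤ ∑ j ∈ Finset.range (k + 1),
      (Nat.factorial j : ℝ) / (Nat.factorial k) * t ^ (k - j) * ρ j := by
  induction k with
  | zero => simpa using h0
  | succ k ih =>
    refine (hstep k hk).trans ?_
    rw [Finset.sum_range_succ]
    have hlast : (Nat.factorial (k + 1) : ℝ) / (Nat.factorial (k + 1)) * t ^ (k + 1 - (k + 1))
        * ρ (k + 1) = ρ (k + 1) := by
      simp [Nat.factorial_ne_zero]
    rw [hlast]
    gcongr
    refine (mul_le_mul_of_nonneg_left (ih (by omega)) (by positivity)).trans_eq ?_
    rw [Finset.mul_sum]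
    refine Finset.sum_congr rfl fun j hj => ?_
    have hj' : j ≤ k := Nat.lt_succ_iff.1 (Finset.mem_range.1 hj)
    rw [Nat.factorial_succ, show k + 1 - j = k - j + 1 by omega, pow_succ]
    push_cast
    field_simp

lemma sum_range_le_sum_psi_mul {N : ℕ} {t : ℝ} (ht : 0 ≤ t) {a ρ : ℕ → ℝ} (h0 : a 0 ≤ ρ 0)
    (hstep : ∀ k < N, a (k + 1) ≤ t / (k + 1) * a k + ρ (k + 1)) :
    ∑ k ∈ Finset.range (N + 1), a k ≤ ∑ k ∈ Finset.range (N + 1), psi N k t * ρ k := by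
  induction N with
  | zero => simpa [psi_self] using h0
  | succ N ih =>
    have hlast := le_sum_of_le_div_mul_add ht h0 hstep le_rfl
    have hprev := ih fun k hk => hstep k (by omega)
    rw [Finset.sum_range_succ]
    refine (add_le_add hprev hlast).trans_eq ?_
    rw [Finset.sum_range_succ _ (N + 1), Finset.sum_range_succ _ (N + 1), ← add_assoc,
      ← Finset.sum_add_distrib]
    congr 1
    · refine Finset.sum_congr rfl fun j hj => ?_
      rw [psi_succ (Nat.lt_succ_iff.1 (Finset.mem_range.1 hj))]
      ring
    · simp [psi_self, Nat.factorial_ne_zero]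

lemma Smat_kronecker_mulVec_zero {n N : ℕ} (M : Matrix (Fin n) (Fin n) ℝ)
    (v : Fin (N + 1) × Fin n → ℝ) (i : Fin n) :
    (Smat N ⊗ₖ M).mulVec v (0, i) = 0 := by
  simp [Matrix.mulVec, dotProduct, Smat]

lemma Smat_kronecker_mulVec_succ {n N : ℕ} (M : Matrix (Fin n) (Fin n) ℝ)
    (v : Fin (N + 1) × Fin n → ℝ) {j k : Fin (N + 1)} (hjk : (j : ℕ) = k + 1) (i : Fin n) :
    (Smat N ⊗ₖ M).mulVec v (j, i)
      = 1 / ((k : ℕ) + 1) * M.mulVec (fun i => v (k, i)) i := by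
  simp only [Matrix.mulVec, dotProduct, Fintype.sum_prod_type, Matrix.kroneckerMap_apply]
  rw [Finset.sum_eq_single k]
  · rw [Finset.mul_sum]
    simp [Smat, hjk, mul_assoc]
  · intro b _ hb
    have hne : (j : ℕ) ≠ b + 1 := fun h => hb (Fin.ext (by omega))
    simp [Smat, hne]
  · simp

/-- the error of the approximate block-system solution is bounded in the
degree-weighted ∞-norm by `Σ_{k=0}^N ψ_k(t) ‖D⁻¹ r_k‖_∞` (the Pi norm on `Fin n → ℝ`
is the sup norm). -/
theorem stmt16 {n N : ℕ} (hN : 1 ≤ N)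
    (G : SimpleGraph (Fin n)) [DecidableRel G.Adj]
    (hdeg : ∀ i, 1 ≤ G.degree i)
    (t : ℝ) (ht : 0 ≤ t) (s : Fin n → ℝ)
    (vhat r : Fin (N + 1) × Fin n → ℝ)
    (hr : r = (fun p => if p.1 = 0 then s p.2 else 0) -
        ((1 : Matrix (Fin (N + 1) × Fin n) (Fin (N + 1) × Fin n) ℝ)
            - Smat N ⊗ₖ (t • transP G)).mulVec vhat)
    (y : Fin n → ℝ)
    (hy : y = fun i => ∑ j : Fin (N + 1), vhat (j, i)) :
    ‖(Dinv G).mulVec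
          ((∑ k ∈ Finset.range (N + 1),
              (t ^ k / (Nat.factorial k : ℝ)) • transP G ^ k).mulVec s)
        - (Dinv G).mulVec y‖
      ≤ ∑ j : Fin (N + 1), psi N (j : ℕ) t * ‖(Dinv G).mulVec fun i => r (j, i)‖ := by
  set P := transP G
  set V : ℕ → Fin n → ℝ := fun k i => vhat (Fin.ofNat (N + 1) k, i) with hV
  set R : ℕ → Fin n → ℝ := fun k i => r (Fin.ofNat (N + 1) k, i) with hR
  set e : ℕ → Fin n → ℝ :=
    fun k => ((t ^ k / (Nat.factorial k : ℝ)) • P ^ k).mulVec s - V k with he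
  have he0 : e 0 = R 0 := by
    ext i
    simp [he, hR, hV, hr, Matrix.sub_mulVec, Smat_kronecker_mulVec_zero]
  have hesucc : ∀ k < N, e (k + 1) = (t / (k + 1)) • P.mulVec (e k) + R (k + 1) := by
    intro k hk
    have hk0 : ((Fin.ofNat (N + 1) k : Fin (N + 1)) : ℕ) = k := Nat.mod_eq_of_lt (by omega)
    have hk1 : ((Fin.ofNat (N + 1) (k + 1) : Fin (N + 1)) : ℕ) = k + 1 :=
      Nat.mod_eq_of_lt (by omega)
    have hne : Fin.ofNat (N + 1) (k + 1) ≠ 0 := fun h => by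
      rw [h, Fin.val_zero] at hk1
      omega
    have hRk : R (k + 1) = (t / (k + 1)) • P.mulVec (V k) - V (k + 1) := by
      ext i
      simp only [hR, hr, Pi.sub_apply, Matrix.sub_mulVec, Matrix.one_mulVec, if_neg hne]
      rw [Smat_kronecker_mulVec_succ _ _ (hk1.trans (by rw [hk0])), hk0, Matrix.smul_mulVec]
      simp only [hV, Pi.smul_apply, smul_eq_mul]
      ring
    rw [hRk]
    simp only [he, Matrix.mulVec_sub, Matrix.smul_mulVec, Matrix.mulVec_smul,
      Matrix.mulVec_mulVec, smul_sub, smul_smul, pow_succ' P]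
    have hc : t ^ (k + 1) / (Nat.factorial (k + 1) : ℝ)
        = t / (k + 1) * (t ^ k / (Nat.factorial k : ℝ)) := by
      rw [Nat.factorial_succ, pow_succ]
      push_cast
      field_simp
    rw [hc]
    abel
  have hyV : y = ∑ k ∈ Finset.range (N + 1), V k := by
    ext i
    rw [hy, Finset.sum_apply, ← Fin.sum_univ_eq_sum_range (fun k => V k i)]
    simp [hV]
  have herr : (Dinv G).mulVec
        ((∑ k ∈ Finset.range (N + 1), (t ^ k / (Nat.factorial k : ℝ)) • P ^ k).mulVec s)
        - (Dinv G).mulVec y = ∑ k ∈ Finset.range (N + 1), (Dinv G).mulVec (e k) := by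
    rw [← Matrix.mulVec_sub, hyV, Matrix.sum_mulVec, ← Finset.sum_sub_distrib,
      Matrix.mulVec_sum]
  have hrhs : ∑ j : Fin (N + 1), psi N (j : ℕ) t * ‖(Dinv G).mulVec fun i => r (j, i)‖
      = ∑ k ∈ Finset.range (N + 1), psi N k t * ‖(Dinv G).mulVec (R k)‖ := by
    rw [← Fin.sum_univ_eq_sum_range (fun k => psi N k t * ‖(Dinv G).mulVec (R k)‖)]
    simp [hR]
  rw [herr, hrhs]
  refine (norm_sum_le _ _).trans (sum_range_le_sum_psi_mul ht (by rw [he0]) fun k hk => ?_)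
  rw [hesucc k hk, Matrix.mulVec_add, Matrix.mulVec_smul]
  refine (norm_add_le _ _).trans ?_
  rw [norm_smul, Real.norm_of_nonneg (by positivity)]
  gcongr
  exact norm_Dinv_mulVec_transP_mulVec_le G _
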